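/- arXiv:1608.06088 — 6 statements merged into one kernel-verified Lean document; each statement's English description precedes it below -/
import Mathlib

section
/- Suppose k, f, s satisfy (i) k' = k^2 − k·f, (ii) s' = 2·k·s and (iv) k·f = s^2 − c at every point of I, and that k(t) ≠ 0 for every t ∈ I. Then equation (iii) holds: f'(t) = f(t)^2 − k(t)·f(t) + 4·s(t)^2 for every t ∈ I. -/
/-- Along an integral curve of `e₁`, the structure equations (i), (ii), (iv) of
the integrability data `k = k₁`, `f = f₂`, `s = σ` together with `k ≠ 0` imply
equation (iii): `f' = f² − k·f + 4·s²`. -/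
theorem deriv_f_eq_of_structure_equations
    (a b : ℝ) (hab : a < b) (I : Set ℝ) (hI : I = Set.Ioo a b)
    (k f s : ℝ → ℝ) (hk : ContDiff ℝ (⊤ : ℕ∞) k) (hf : ContDiff ℝ (⊤ : ℕ∞) f)
    (hs : ContDiff ℝ (⊤ : ℕ∞) s) (c : ℝ)
    (h1 : ∀ t ∈ I, deriv k t = k t ^ 2 - k t * f t)
    (h2 : ∀ t ∈ I, deriv s t = 2 * k t * s t)
    (h4 : ∀ t ∈ I, k t * f t = s t ^ 2 - c)
    (hk0 : ∀ t ∈ I, k t ≠ 0) :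
    ∀ t ∈ I, deriv f t = f t ^ 2 - k t * f t + 4 * s t ^ 2 := by
  intro t ht
  have hI_nhds : I ∈ nhds t := by
    subst hI
    exact isOpen_Ioo.mem_nhds ht
  have hk' := (hk.differentiable (by simp) t).hasDerivAt
  have hf' := (hf.differentiable (by simp) t).hasDerivAt
  have hs' := (hs.differentiable (by simp) t).hasDerivAt
  have h4_eventually : k * f =ᶠ[nhds t] fun x => s x ^ 2 - c :=
    Filter.eventually_of_mem hI_nhds h4
  have key := (hk'.mul hf').unique
    (((hs'.pow 2).sub_const c).congr_of_eventuallyEq h4_eventually)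
  rw [h1 t ht, h2 t ht] at key
  apply mul_left_cancel₀ (hk0 t ht)
  norm_num at key
  linear_combination key
end

section
/- Suppose k, f, s satisfy (i) k' = k^2 − k·f, (ii) s' = 2·k·s and (iii) f' = f^2 − k·f + 4·s^2 at every point of I, and define A : I → ℝ by A = −k^3 + 2·f·k^2 + 4·s^2·k. Then the identity A'' − (f + k)·A' − A·(f^2 − k·f + 4·s^2) + (k·f − 4·s^2)·f·k^2 = −9·k^5 + 19·f·k^4 + (164·s^2 − 9·f^2)·k^3 − 120·s^2·f·k^2 − 32·s^4·k holds at every point of I. (The left-hand side is the reduced triharmonic equation Δ^M A − A·e₁(f₂) − (e₁(f₂) − f₂^2)·f₂·k₁^2 of the paper, so the triharmonic condition is equivalent to the vanishing of the displayed quintic.) -/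
/-- The reduced triharmonic expression
`A'' − (f + k)·A' − A·(f² − k·f + 4·s²) + (k·f − 4·s²)·f·k²` equals the quintic
`−9·k⁵ + 19·f·k⁴ + (164·s² − 9·f²)·k³ − 120·s²·f·k² − 32·s⁴·k` under the
structure equations (i)–(iii), where `A = −k³ + 2·f·k² + 4·s²·k`. -/
theorem reduced_triharmonic_identity
    (a b : ℝ) (hab : a < b) (I : Set ℝ) (hI : I = Set.Ioo a b)
    (k f s : ℝ → ℝ) (hk : ContDiff ℝ (⊤ : ℕ∞) k) (hf : ContDiff ℝ (⊤ : ℕ∞) f)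
    (hs : ContDiff ℝ (⊤ : ℕ∞) s) (c : ℝ)
    (h1 : ∀ t ∈ I, deriv k t = k t ^ 2 - k t * f t)
    (h2 : ∀ t ∈ I, deriv s t = 2 * k t * s t)
    (h3 : ∀ t ∈ I, deriv f t = f t ^ 2 - k t * f t + 4 * s t ^ 2)
    (A : ℝ → ℝ)
    (hA : ∀ t, A t = -(k t ^ 3) + 2 * f t * k t ^ 2 + 4 * s t ^ 2 * k t) :
    ∀ t ∈ I,
      deriv (deriv A) t - (f t + k t) * deriv A t
        - A t * (f t ^ 2 - k t * f t + 4 * s t ^ 2)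
        + (k t * f t - 4 * s t ^ 2) * f t * k t ^ 2 =
      -9 * k t ^ 5 + 19 * f t * k t ^ 4 + (164 * s t ^ 2 - 9 * f t ^ 2) * k t ^ 3
        - 120 * s t ^ 2 * f t * k t ^ 2 - 32 * s t ^ 4 * k t := by
  have hkd : Differentiable ℝ k := hk.differentiable (by simp)
  have hfd : Differentiable ℝ f := hf.differentiable (by simp)
  have hsd : Differentiable ℝ s := hs.differentiable (by simp)
  have hA' : ∀ t ∈ I, deriv A t = -3 * k t ^ 4 + 5 * f t * k t ^ 3 - 2 * f t ^ 2 * k t ^ 2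
      + 28 * s t ^ 2 * k t ^ 2 - 4 * s t ^ 2 * k t * f t := by
    intro t ht
    have dk := h1 t ht ▸ (hkd t).hasDerivAt
    have ds := h2 t ht ▸ (hsd t).hasDerivAt
    have df := h3 t ht ▸ (hfd t).hasDerivAt
    have H := ((dk.pow 3).neg.add ((df.const_mul 2).mul (dk.pow 2))).add
      (((ds.pow 2).const_mul 4).mul dk)
    rw [show A = _ from funext hA]
    refine HasDerivAt.deriv (H.congr_deriv ?_)
    simp only [Pi.pow_apply]
    push_cast
    ring
  intro t ht
  have dk := h1 t ht ▸ (hkd t).hasDerivAt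
  have ds := h2 t ht ▸ (hsd t).hasDerivAt
  have df := h3 t ht ▸ (hfd t).hasDerivAt
  have hI' : I ∈ nhds t := (hI ▸ isOpen_Ioo : IsOpen I).mem_nhds ht
  have H := (((((dk.pow 4).const_mul (-3)).add ((df.const_mul 5).mul (dk.pow 3))).sub
    (((df.pow 2).const_mul 2).mul (dk.pow 2))).add
    (((ds.pow 2).const_mul 28).mul (dk.pow 2))).sub
    ((((ds.pow 2).const_mul 4).mul dk).mul df)
  have hA'' := (H.congr_of_eventuallyEq (Filter.mem_of_superset hI' hA')).deriv
  rw [hA'', hA' t ht, hA t]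
  simp only [Pi.pow_apply, Pi.mul_apply]
  push_cast
  ring
end

section
/- Suppose k, f, s satisfy (i) k' = k^2 − k·f, (ii) s' = 2·k·s and (iii) f' = f^2 − k·f + 4·s^2 at every point of I, that k(t) ≠ 0 for every t ∈ I, and that f·k^3 + (−202·s^2 + f^2)·k^2 + 200·s^2·f·k + 304·s^4 = 0 at every point of I. Then f·k^3 + (−f^2 − 604·s^2)·k^2 + 606·s^2·f·k + 1616·s^4 = 0 at every point of I. -/
/-- Differentiating the relation
`f·k³ + (−202·s² + f²)·k² + 200·s²·f·k + 304·s⁴ = 0` along the flow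
(using the structure equations (i)–(iii) and `k ≠ 0`) yields
`f·k³ + (−f² − 604·s²)·k² + 606·s²·f·k + 1616·s⁴ = 0`. -/
theorem deriv_cubic_relation
    (a b : ℝ) (hab : a < b) (I : Set ℝ) (hI : I = Set.Ioo a b)
    (k f s : ℝ → ℝ) (hk : ContDiff ℝ (⊤ : ℕ∞) k) (hf : ContDiff ℝ (⊤ : ℕ∞) f)
    (hs : ContDiff ℝ (⊤ : ℕ∞) s) (c : ℝ)
    (h1 : ∀ t ∈ I, deriv k t = k t ^ 2 - k t * f t)
    (h2 : ∀ t ∈ I, deriv s t = 2 * k t * s t)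
    (h3 : ∀ t ∈ I, deriv f t = f t ^ 2 - k t * f t + 4 * s t ^ 2)
    (hk0 : ∀ t ∈ I, k t ≠ 0)
    (hrel : ∀ t ∈ I,
      f t * k t ^ 3 + (-202 * s t ^ 2 + f t ^ 2) * k t ^ 2
        + 200 * s t ^ 2 * f t * k t + 304 * s t ^ 4 = 0) :
    ∀ t ∈ I,
      f t * k t ^ 3 + (-(f t ^ 2) - 604 * s t ^ 2) * k t ^ 2
        + 606 * s t ^ 2 * f t * k t + 1616 * s t ^ 4 = 0 := by
  intro t ht
  have dk : HasDerivAt k (k t ^ 2 - k t * f t) t := by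
    rw [← h1 t ht]
    exact (hk.differentiable (by simp) t).hasDerivAt
  have ds : HasDerivAt s (2 * k t * s t) t := by
    rw [← h2 t ht]
    exact (hs.differentiable (by simp) t).hasDerivAt
  have df : HasDerivAt f (f t ^ 2 - k t * f t + 4 * s t ^ 2) t := by
    rw [← h3 t ht]
    exact (hf.differentiable (by simp) t).hasDerivAt
  have hderiv := ((((df.mul (dk.pow 3)).add
    ((((ds.pow 2).const_mul (-202)).add (df.pow 2)).mul (dk.pow 2))).add
    ((((ds.pow 2).const_mul 200).mul df).mul dk)).add ((ds.pow 4).const_mul 304))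
  have hIt : I ∈ nhds t := by
    subst hI
    exact isOpen_Ioo.mem_nhds ht
  have hzero := ((hasDerivAt_const t (0 : ℝ)).congr_of_eventuallyEq
    (Filter.eventually_of_mem hIt hrel)).unique hderiv
  apply mul_left_cancel₀ (mul_ne_zero two_ne_zero (hk0 t ht))
  simp only [Pi.pow_apply, Pi.mul_apply, Pi.add_apply] at hzero
  norm_num at hzero
  linear_combination -hzero
end

section
/- Suppose k, f, s satisfy (i) k' = k^2 − k·f, (ii) s' = 2·k·s and (iii) f' = f^2 − k·f + 4·s^2 at every point of I, that k(t) ≠ 0 for every t ∈ I, and that (201·s^2 + f^2)·k^2 − 203·s^2·f·k − 656·s^4 = 0 at every point of I. Then −f^2·k^2 + 2·s^2·f·k − 354·s^4 = 0 at every point of I. -/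
/-- Differentiating the relation
`(201·s² + f²)·k² − 203·s²·f·k − 656·s⁴ = 0` along the flow (using the
structure equations (i)–(iii) and `k ≠ 0`) and eliminating yields
`−f²·k² + 2·s²·f·k − 354·s⁴ = 0`. -/
theorem deriv_quadratic_relation
    (a b : ℝ) (hab : a < b) (I : Set ℝ) (hI : I = Set.Ioo a b)
    (k f s : ℝ → ℝ) (hk : ContDiff ℝ (⊤ : ℕ∞) k) (hf : ContDiff ℝ (⊤ : ℕ∞) f)
    (hs : ContDiff ℝ (⊤ : ℕ∞) s) (c : ℝ)
    (h1 : ∀ t ∈ I, deriv k t = k t ^ 2 - k t * f t)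
    (h2 : ∀ t ∈ I, deriv s t = 2 * k t * s t)
    (h3 : ∀ t ∈ I, deriv f t = f t ^ 2 - k t * f t + 4 * s t ^ 2)
    (hk0 : ∀ t ∈ I, k t ≠ 0)
    (hrel : ∀ t ∈ I,
      (201 * s t ^ 2 + f t ^ 2) * k t ^ 2 - 203 * s t ^ 2 * f t * k t
        - 656 * s t ^ 4 = 0) :
    ∀ t ∈ I,
      -(f t ^ 2) * k t ^ 2 + 2 * s t ^ 2 * f t * k t - 354 * s t ^ 4 = 0 := by
  intro t ht
  have hk' := (hk.differentiable (by simp) t).hasDerivAt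
  have hf' := (hf.differentiable (by simp) t).hasDerivAt
  have hs' := (hs.differentiable (by simp) t).hasDerivAt
  rw [h1 t ht] at hk'
  rw [h2 t ht] at hs'
  rw [h3 t ht] at hf'
  have hderiv := (((((hs'.fun_pow 2).const_mul 201).fun_add (hf'.fun_pow 2)).fun_mul
    (hk'.fun_pow 2)).fun_sub ((((hs'.fun_pow 2).const_mul 203).fun_mul hf').fun_mul hk')).fun_sub
    ((hs'.fun_pow 4).const_mul 656)
  have hI_nhds : I ∈ nhds t := by
    subst hI
    exact isOpen_Ioo.mem_nhds ht
  have hzero : HasDerivAt (fun x => (201 * s x ^ 2 + f x ^ 2) * k x ^ 2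
      - 203 * s x ^ 2 * f x * k x - 656 * s x ^ 4) 0 t :=
    (hasDerivAt_const t (0 : ℝ)).congr_of_eventuallyEq
      (Filter.eventually_of_mem hI_nhds hrel)
  have heq := hderiv.unique hzero
  have hfactor : s t ^ 2 * (201 * k t ^ 2 - 201 * k t * f t - 1010 * s t ^ 2) = 0 := by
    refine (mul_eq_zero.mp ?_).resolve_left (mul_ne_zero (by norm_num : (6 : ℝ) ≠ 0) (hk0 t ht))
    norm_num at heq
    linear_combination heq
  linear_combination hfactor - hrel t ht
end

section
/- Suppose k, f, s satisfy (i) k' = k^2 − k·f, (iii) f' = f^2 − k·f + 4·s^2 and (iv) k·f = s^2 − c at every point of I. Then the identity −k'' + (f + k)·k' = 5·k·s^2 − k^3 − k·c + f·(k^2 − s^2 + c) holds at every point of I. (The left-hand side equals −Δ^M k₁, the negative Laplacian of the integrability datum k₁, in the reduced setting.) -/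
/-- Under the structure equations (i), (iii), (iv), the negative Laplacian of
`k = k₁` in the reduced setting satisfies
`−k'' + (f + k)·k' = 5·k·s² − k³ − k·c + f·(k² − s² + c)`. -/
theorem neg_laplacian_k_identity
    (a b : ℝ) (hab : a < b) (I : Set ℝ) (hI : I = Set.Ioo a b)
    (k f s : ℝ → ℝ) (hk : ContDiff ℝ (⊤ : ℕ∞) k) (hf : ContDiff ℝ (⊤ : ℕ∞) f)
    (hs : ContDiff ℝ (⊤ : ℕ∞) s) (c : ℝ)
    (h1 : ∀ t ∈ I, deriv k t = k t ^ 2 - k t * f t)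
    (h3 : ∀ t ∈ I, deriv f t = f t ^ 2 - k t * f t + 4 * s t ^ 2)
    (h4 : ∀ t ∈ I, k t * f t = s t ^ 2 - c) :
    ∀ t ∈ I,
      -(deriv (deriv k) t) + (f t + k t) * deriv k t =
        5 * k t * s t ^ 2 - k t ^ 3 - k t * c
          + f t * (k t ^ 2 - s t ^ 2 + c) := by
  intro t ht
  have hI_open : IsOpen I := hI ▸ isOpen_Ioo
  have hk' : HasDerivAt k (deriv k t) t :=
    ((hk.differentiable (by simp)) t).hasDerivAt
  have hf' : HasDerivAt f (deriv f t) t :=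
    ((hf.differentiable (by simp)) t).hasDerivAt
  have heq : deriv k =ᶠ[nhds t] fun u => k u ^ 2 - k u * f u :=
    Filter.eventually_of_mem (hI_open.mem_nhds ht) h1
  have hk'' : deriv (deriv k) t =
      2 * k t * deriv k t - (deriv k t * f t + k t * deriv f t) := by
    rw [heq.deriv_eq]
    simpa using ((hk'.fun_pow 2).fun_sub (hk'.fun_mul hf')).deriv
  rw [hk'', h1 t ht, h3 t ht]
  linear_combination (k t - f t) * h4 t ht
end

section
/- Suppose k, f, s satisfy (i) k' = k^2 − k·f, (iii) f' = f^2 − k·f + 4·s^2 and (iv) k·f = s^2 − c at every point of I. Then the identity −k'' + (f + k)·k' + k·(k·f − 4·s^2 + f^2) = k·(3·s^2 − k^2 − 3·c) holds at every point of I. (The left-hand side is the reduced biharmonic equation −Δ^M k₁ + k₁·(−K^N + f₁^2 + f₂^2) of the paper with f₁ = 0 and K^N = e₁(f₂) − f₂^2, so the biharmonic condition is equivalent to k·(3·s^2 − k^2 − 3·c) = 0.) -/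
/-- Under the structure equations (i), (iii), (iv), the reduced biharmonic
expression `−k'' + (f + k)·k' + k·(k·f − 4·s² + f²)` equals
`k·(3·s² − k² − 3·c)`, so biharmonicity is equivalent to the vanishing of the
latter. -/
theorem reduced_biharmonic_identity
    (a b : ℝ) (hab : a < b) (I : Set ℝ) (hI : I = Set.Ioo a b)
    (k f s : ℝ → ℝ) (hk : ContDiff ℝ (⊤ : ℕ∞) k) (hf : ContDiff ℝ (⊤ : ℕ∞) f)
    (hs : ContDiff ℝ (⊤ : ℕ∞) s) (c : ℝ)
    (h1 : ∀ t ∈ I, deriv k t = k t ^ 2 - k t * f t)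
    (h3 : ∀ t ∈ I, deriv f t = f t ^ 2 - k t * f t + 4 * s t ^ 2)
    (h4 : ∀ t ∈ I, k t * f t = s t ^ 2 - c) :
    ∀ t ∈ I,
      -(deriv (deriv k) t) + (f t + k t) * deriv k t
        + k t * (k t * f t - 4 * s t ^ 2 + f t ^ 2) =
      k t * (3 * s t ^ 2 - k t ^ 2 - 3 * c) := by
  subst hI
  intro t ht
  have hk' : HasDerivAt k (deriv k t) t := (hk.differentiable (by simp) t).hasDerivAt
  have hf' : HasDerivAt f (deriv f t) t := (hf.differentiable (by simp) t).hasDerivAt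
  have heq : deriv k =ᶠ[nhds t] fun x => k x ^ 2 - k x * f x :=
    Filter.eventuallyEq_of_mem (isOpen_Ioo.mem_nhds ht) h1
  have hkk : deriv (deriv k) t
      = 2 * k t * deriv k t - (deriv k t * f t + k t * deriv f t) := by
    rw [heq.deriv_eq]
    simpa using ((hk'.fun_pow 2).fun_sub (hk'.fun_mul hf')).deriv
  rw [hkk, h3 t ht, h1 t ht]
  linear_combination 3 * k t * h4 t ht
end
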